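/- arXiv:2401.13819 — 11 statements merged into one kernel-verified Lean document; each statement's English description precedes it below -/
import Mathlib

section
/- For every p ∈ [0,1], g(p,3) ≥ g(p*,3); that is, over the interval [0,1] the cubic function p ↦ g(p,3) = 1 + ((2+p)/3)^3 + ((2(1-p))/3)^3 attains its minimum at p = p* = (10 - 6√2)/7. -/
noncomputable def g (p : ℝ) (d : ℕ) : ℝ :=
  1 + (1 - (1 - p) / (d : ℝ)) ^ d + ((1 - p) * (1 - 1 / (d : ℝ))) ^ d

noncomputable def pstar : ℝ := (10 - 6 * Real.sqrt 2) / 7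

/-- `pstar` is a critical point of the cubic `p ↦ g p 3`. -/
theorem seven_mul_pstar_sq : 7 * pstar ^ 2 = 20 * pstar - 4 := by
  have h : Real.sqrt 2 ^ 2 = 2 := Real.sq_sqrt (by norm_num)
  unfold pstar
  linear_combination (36 / 7) * h

theorem g_three_sub_g_pstar (p : ℝ) :
    g p 3 - g pstar 3 = (p - pstar) ^ 2 * (30 - 7 * p - 14 * pstar) / 27 := by
  unfold g
  push_cast
  linear_combination ((pstar - p) / 9) * seven_mul_pstar_sq

theorem g_cubic_min_at_pstar :
    ∀ p ∈ Set.Icc (0 : ℝ) 1, g pstar 3 ≤ g p 3 := by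
  rintro p ⟨-, hp⟩
  have hs : 14 * pstar ≤ 20 := by
    unfold pstar
    linarith [Real.sqrt_nonneg 2]
  have h : 0 ≤ (p - pstar) ^ 2 * (30 - 7 * p - 14 * pstar) / 27 :=
    div_nonneg (mul_nonneg (sq_nonneg _) (by linarith)) (by norm_num)
  linarith [g_three_sub_g_pstar p]
end

section
/- For every positive integer d, g(p*,d) ≤ g(p*,3); that is, over positive integers d the function d ↦ g(p*,d) attains its maximum at d = 3. -/
theorem one_sub_pstar_mem_Icc : 1 - pstar ∈ Set.Icc (0.7835 : ℝ) 0.7837 := by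
  have h₁ : (1.4142 : ℝ) ≤ √2 := Real.le_sqrt_of_sq_le (by norm_num)
  have h₂ : √2 ≤ (1.4142136 : ℝ) := Real.sqrt_le_left (by norm_num) |>.2 (by norm_num)
  unfold pstar
  constructor <;> linarith

theorem g_le_of_one_sub_mem_Icc {p a b : ℝ} {d : ℕ} (hd : 0 < d) (ha : 0 ≤ a) (hb : b ≤ 1)
    (hp : 1 - p ∈ Set.Icc a b) :
    g p d ≤ 1 + (1 - a / d) ^ d + (b * (1 - 1 / d)) ^ d := by
  obtain ⟨h₁, h₂⟩ := hp
  have hd' : (1 : ℝ) ≤ d := by exact_mod_cast hd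
  have hinv : 1 / (d : ℝ) ≤ 1 := (div_le_one (by positivity)).2 hd'
  have hdiv : (1 - p) / (d : ℝ) ≤ 1 := (div_le_one (by positivity)).2 (by linarith)
  have hc : 0 ≤ 1 - 1 / (d : ℝ) := by linarith
  have hs : 0 ≤ 1 - (1 - p) / (d : ℝ) := by linarith
  have hp' : 0 ≤ 1 - p := ha.trans h₁
  unfold g
  gcongr

theorem le_g_of_one_sub_mem_Icc {p a b : ℝ} {d : ℕ} (hd : 0 < d) (ha : 0 ≤ a) (hb : b ≤ 1)
    (hp : 1 - p ∈ Set.Icc a b) :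
    1 + (1 - b / d) ^ d + (a * (1 - 1 / d)) ^ d ≤ g p d := by
  obtain ⟨h₁, h₂⟩ := hp
  have hd' : (1 : ℝ) ≤ d := by exact_mod_cast hd
  have hinv : 1 / (d : ℝ) ≤ 1 := (div_le_one (by positivity)).2 hd'
  have hdiv : b / (d : ℝ) ≤ 1 := (div_le_one (by positivity)).2 (by linarith)
  have hc : 0 ≤ 1 - 1 / (d : ℝ) := by linarith
  have hs : 0 ≤ 1 - b / (d : ℝ) := by linarith
  unfold g
  gcongr

theorem g_le_exp {p : ℝ} {d : ℕ} (hd : 0 < d) (h₀ : 0 ≤ p) (h₁ : p ≤ 1) :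
    g p d ≤ 1 + Real.exp (-(1 - p)) + (1 - p) ^ d * Real.exp (-1) := by
  have hd' : (1 : ℝ) ≤ d := by exact_mod_cast hd
  have hp : 0 ≤ 1 - p := by linarith
  unfold g
  rw [mul_pow]
  gcongr
  · exact Real.one_sub_div_pow_le_exp_neg (by linarith)
  · exact Real.one_sub_div_pow_le_exp_neg hd'

theorem exp_neg_lt_of_sum_pow_div_factorial {x c : ℝ} (n : ℕ) (hx : 0 ≤ x) (hc : 0 < c)
    (h : c⁻¹ < ∑ i ∈ Finset.range n, x ^ i / i.factorial) : Real.exp (-x) < c := by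
  rw [Real.exp_neg]
  exact inv_lt_of_inv_lt₀ hc (h.trans_le (Real.sum_le_exp_of_nonneg hx n))

theorem g_pstar_le_of_six_le {d : ℕ} (hd : 6 ≤ d) : g pstar d ≤ 1.545 := by
  obtain ⟨h₁, h₂⟩ := one_sub_pstar_mem_Icc
  have hexp : Real.exp (-(1 - pstar)) ≤ 0.458 :=
    (Real.exp_le_exp.2 (neg_le_neg h₁)).trans
      (exp_neg_lt_of_sum_pow_div_factorial 6 (by norm_num) (by norm_num)
        (by norm_num [Finset.sum_range_succ, Nat.factorial])).le
  have hexp' : Real.exp (-1) ≤ 0.369 :=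
    (exp_neg_lt_of_sum_pow_div_factorial 6 (by norm_num) (by norm_num)
      (by norm_num [Finset.sum_range_succ, Nat.factorial])).le
  have hpow : (1 - pstar) ^ d ≤ 0.7837 ^ 6 :=
    (pow_le_pow_of_le_one (by linarith) (by linarith) hd).trans
      (pow_le_pow_left₀ (by linarith) h₂ 6)
  calc g pstar d
      ≤ 1 + Real.exp (-(1 - pstar)) + (1 - pstar) ^ d * Real.exp (-1) :=
        g_le_exp (by lia) (by linarith) (by linarith)
    _ ≤ 1 + 0.458 + 0.7837 ^ 6 * 0.369 := by gcongr
    _ ≤ 1.545 := by norm_num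

theorem g_pstar_max_at_three :
    ∀ d : ℕ, 0 < d → g pstar d ≤ g pstar 3 := by
  intro d hd
  by_cases h3 : d = 3
  · rw [h3]
  have hlower : 1.545 ≤ g pstar 3 :=
    le_trans (by norm_num)
      (le_g_of_one_sub_mem_Icc (by norm_num) (by norm_num) (by norm_num) one_sub_pstar_mem_Icc)
  refine le_trans ?_ hlower
  rcases le_or_gt 6 d with h6 | h6
  · exact g_pstar_le_of_six_le h6
  · refine (g_le_of_one_sub_mem_Icc hd (by norm_num) (by norm_num) one_sub_pstar_mem_Icc).trans ?_
    interval_cases d <;> first | contradiction | norm_num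
end

section
/- For every positive integer d, g(p*,d) ≤ 1 + e^{p*-1} + e^{-1}(1-p*)^d, and moreover for every integer d ≥ 7 this upper bound satisfies 1 + e^{p*-1} + e^{-1}(1-p*)^d ≤ 1.542; consequently g(p*,d) ≤ 1.542 for all integers d ≥ 7. -/
lemma pstar_mem_Icc : pstar ∈ Set.Icc (0.2163 : ℝ) 0.22 := by
  have h₁ : (1.41 : ℝ) ≤ √2 := Real.le_sqrt_of_sq_le (by norm_num)
  have h₂ : √2 ≤ (1.4143 : ℝ) := Real.sqrt_le_iff.mpr (by norm_num)
  unfold pstar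
  constructor <;> linarith

lemma g_le_one_add_exp_add {p : ℝ} (hp₀ : 0 ≤ p) (hp₁ : p ≤ 1) {d : ℕ} (hd : 0 < d) :
    g p d ≤ 1 + Real.exp (p - 1) + Real.exp (-1) * (1 - p) ^ d := by
  have hd' : (1 : ℝ) ≤ d := by exact_mod_cast hd
  have h₁ : (1 - (1 - p) / (d : ℝ)) ^ d ≤ Real.exp (p - 1) := by
    simpa using Real.one_sub_div_pow_le_exp_neg (n := d) (t := 1 - p) (by linarith)
  have h₂ : (1 - 1 / (d : ℝ)) ^ d ≤ Real.exp (-1) := Real.one_sub_div_pow_le_exp_neg hd'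
  have h₃ := mul_le_mul_of_nonneg_right h₂ (pow_nonneg (sub_nonneg.mpr hp₁) d)
  unfold g
  rw [mul_pow]
  linarith

lemma one_add_exp_pstar_add_le {d : ℕ} (hd : 7 ≤ d) :
    1 + Real.exp (pstar - 1) + Real.exp (-1) * (1 - pstar) ^ d ≤ 1.542 := by
  obtain ⟨hl, hu⟩ := pstar_mem_Icc
  have h₁ : Real.exp (pstar - 1) ≤ 0.46 := by
    have h : (2.178 : ℝ) ≤ Real.exp 0.78 := by
      refine le_trans ?_ (Real.sum_le_exp_of_nonneg (by norm_num) 5)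
      norm_num [Finset.sum_range_succ, Nat.factorial]
    calc Real.exp (pstar - 1) ≤ Real.exp (-0.78) := Real.exp_le_exp.mpr (by linarith)
      _ = (Real.exp 0.78)⁻¹ := Real.exp_neg _
      _ ≤ (2.178 : ℝ)⁻¹ := inv_anti₀ (by norm_num) h
      _ ≤ 0.46 := by norm_num
  have h₂ : (1 - pstar) ^ d ≤ 0.182 :=
    calc (1 - pstar) ^ d ≤ (1 - pstar) ^ 7 :=
          pow_le_pow_of_le_one (by linarith) (by linarith) hd
      _ ≤ (0.7837 : ℝ) ^ 7 := pow_le_pow_left₀ (by linarith) (by linarith) 7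
      _ ≤ 0.182 := by norm_num
  have h₃ : Real.exp (-1) ≤ 0.37 := Real.exp_neg_one_lt_d9.le.trans (by norm_num)
  have h₄ : Real.exp (-1) * (1 - pstar) ^ d ≤ 0.37 * 0.182 :=
    mul_le_mul h₃ h₂ (pow_nonneg (by linarith) d) (by norm_num)
  linarith

theorem g_pstar_upper_bound :
    (∀ d : ℕ, 0 < d →
      g pstar d ≤ 1 + Real.exp (pstar - 1) + Real.exp (-1) * (1 - pstar) ^ d) ∧
    (∀ d : ℕ, 7 ≤ d →
      1 + Real.exp (pstar - 1) + Real.exp (-1) * (1 - pstar) ^ d ≤ 1.542) ∧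
    (∀ d : ℕ, 7 ≤ d → g pstar d ≤ 1.542) := by
  have h : ∀ d : ℕ, 0 < d →
      g pstar d ≤ 1 + Real.exp (pstar - 1) + Real.exp (-1) * (1 - pstar) ^ d := fun d hd =>
    g_le_one_add_exp_add (by linarith [pstar_mem_Icc.1]) (by linarith [pstar_mem_Icc.2]) hd
  exact ⟨h, fun d hd => one_add_exp_pstar_add_le hd,
    fun d hd => (h d (by omega)).trans (one_add_exp_pstar_add_le hd)⟩
end

section
/- For all real numbers a ∈ (0,1), b ∈ (0,1), μ ∈ [0,1] and every positive integer d, the quantity 1 - a^d + μ·((1-ab)^d - 1 - a^d(1-b)^d + a^d) is strictly positive; indeed it is at least (1 - a^d)·(1 - μ(1 - (1-b)^d)) > 0. -/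
theorem convexity_key_positive (a b μ : ℝ) (ha : a ∈ Set.Ioo (0 : ℝ) 1)
    (hb : b ∈ Set.Ioo (0 : ℝ) 1) (hμ : μ ∈ Set.Icc (0 : ℝ) 1)
    (d : ℕ) (hd : 0 < d) :
    (1 - a ^ d) * (1 - μ * (1 - (1 - b) ^ d)) ≤
      1 - a ^ d + μ * ((1 - a * b) ^ d - 1 - a ^ d * (1 - b) ^ d + a ^ d) ∧
    0 < (1 - a ^ d) * (1 - μ * (1 - (1 - b) ^ d)) ∧
    0 < 1 - a ^ d + μ * ((1 - a * b) ^ d - 1 - a ^ d * (1 - b) ^ d + a ^ d) := by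
  obtain ⟨ha0, ha1⟩ := ha
  obtain ⟨hb0, hb1⟩ := hb
  obtain ⟨hμ0, hμ1⟩ := hμ
  have had : a ^ d < 1 := pow_lt_one₀ ha0.le ha1 hd.ne'
  have hc0 : 0 < (1 - b) ^ d := pow_pos (by linarith) d
  have hc1 : (1 - b) ^ d ≤ 1 := pow_le_one₀ (by linarith) (by linarith)
  have hle : (1 - b) ^ d ≤ (1 - a * b) ^ d :=
    pow_le_pow_left₀ (by linarith) (by nlinarith) d
  have hbound : (1 - a ^ d) * (1 - μ * (1 - (1 - b) ^ d)) ≤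
      1 - a ^ d + μ * ((1 - a * b) ^ d - 1 - a ^ d * (1 - b) ^ d + a ^ d) := by
    linear_combination μ * hle
  have hpos : 0 < (1 - a ^ d) * (1 - μ * (1 - (1 - b) ^ d)) :=
    mul_pos (by linarith) (by nlinarith)
  exact ⟨hbound, hpos, hpos.trans_le hbound⟩
end

section
/- For all real numbers a ∈ (0,1), b ∈ (0,1) and every integer d ≥ 2, the quantity ρ(a,b,d) = 1 - (1-ab)^d - a^d + a^d(1-b)^d is strictly positive. Moreover ρ(0,b,d) = ρ(1,b,d) = 0 and a ↦ ρ(a,b,d) is concave on (0,1). -/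
theorem rho_positive_and_concave (b : ℝ) (hb : b ∈ Set.Ioo (0 : ℝ) 1)
    (d : ℕ) (hd : 2 ≤ d) :
    (∀ a ∈ Set.Ioo (0 : ℝ) 1,
      0 < 1 - (1 - a * b) ^ d - a ^ d + a ^ d * (1 - b) ^ d) ∧
    (1 - (1 - (0 : ℝ) * b) ^ d - (0 : ℝ) ^ d + (0 : ℝ) ^ d * (1 - b) ^ d = 0) ∧
    (1 - (1 - (1 : ℝ) * b) ^ d - (1 : ℝ) ^ d + (1 : ℝ) ^ d * (1 - b) ^ d = 0) ∧
    ConcaveOn ℝ (Set.Ioo (0 : ℝ) 1)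
      (fun a : ℝ => 1 - (1 - a * b) ^ d - a ^ d + a ^ d * (1 - b) ^ d) := by
  obtain ⟨hb0, hb1⟩ := hb
  have hd0 : d ≠ 0 := by omega
  have hpow : (1 - b) ^ d < 1 := pow_lt_one₀ (by linarith) (by linarith) hd0
  refine ⟨?_, by simp [hd0], by simp, convex_Ioo 0 1, ?_⟩
  · rintro a ⟨ha0, ha1⟩
    have hconv := (convexOn_pow (𝕜 := ℝ) d).2 (Set.mem_Ici.2 zero_le_one)
      (Set.mem_Ici.2 (sub_nonneg.2 hb1.le)) (sub_nonneg.2 ha1.le) ha0.le (by ring)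
    have hlt : a ^ d < a := pow_lt_self_of_lt_one₀ ha0 ha1 (by omega)
    have harg : (1 - a) * 1 + a * (1 - b) = 1 - a * b := by ring
    simp only [smul_eq_mul, one_pow, harg] at hconv
    nlinarith [mul_pos (sub_pos.2 hlt) (sub_pos.2 hpow)]
  · rintro x ⟨hx0, hx1⟩ y ⟨hy0, hy1⟩ s t hs ht hst
    have hx : 0 ≤ 1 - x * b := by nlinarith
    have hy : 0 ≤ 1 - y * b := by nlinarith
    have hconv := (convexOn_pow (𝕜 := ℝ) d).2 (Set.mem_Ici.2 hx) (Set.mem_Ici.2 hy) hs ht hst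
    have hconv' := (convexOn_pow (𝕜 := ℝ) d).2 (Set.mem_Ici.2 hx0.le) (Set.mem_Ici.2 hy0.le)
      hs ht hst
    have harg : s * (1 - x * b) + t * (1 - y * b) = 1 - (s * x + t * y) * b := by
      linear_combination hst
    simp only [smul_eq_mul, harg] at hconv hconv' ⊢
    have hmul := mul_le_mul_of_nonneg_right hconv' (sub_pos.2 hpow).le
    linear_combination hmul + hconv + hst
end

section
/- For every p ∈ (0,1), every positive integer d, and every fixed μ_A ∈ [0,1], the function μ_C ↦ ζ(p,d,μ_A, 1-μ_A-μ_C, μ_C) is convex on the interval [0, 1-μ_A]; likewise, for every fixed μ_B ∈ [0,1], the function μ_C ↦ ζ(p,d,1-μ_B-μ_C, μ_B, μ_C) is convex on [0, 1-μ_B]. -/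
noncomputable def alphaAlg : ℝ := g pstar 3

noncomputable def zeta (p : ℝ) (d : ℕ) (μA μB μC : ℝ) : ℝ :=
  let T : ℝ := 1 - μA + μA * (1 - (1 - p) / (d : ℝ)) ^ d
  let E : ℝ := 1 - μB + Real.exp (p - 1) * μB
  let Q : ℝ := (1 - p) ^ d * (1 - μA + μA * (1 - 1 / (d : ℝ)) ^ d)
  1 + T / 2 + E * T / 2 + μC * (1 - p) * E * T + (1 - μC * (1 - p)) * E * Q

noncomputable def psi (p : ℝ) (d : ℕ) (μA μB μC : ℝ) : ℝ :=
  zeta p d μA μB μC / (μA + 1.5 * μB + 3 * μC)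

theorem convexOn_quadratic {s : Set ℝ} (hs : Convex ℝ s) {a b c : ℝ} (ha : 0 ≤ a) :
    ConvexOn ℝ s (fun x : ℝ => a * x ^ 2 + b * x + c) := by
  refine ⟨hs, fun x _ y _ t u ht hu htu => ?_⟩
  obtain rfl : u = 1 - t := by linarith
  have h : 0 ≤ a * (t * (1 - t) * (x - y) ^ 2) := by positivity
  simp only [smul_eq_mul]
  linarith

/-- Convexity of `x ↦ (1 - x / d) ^ d` on `[0, 1]`, compared with its chord. -/
theorem one_sub_div_pow_le_chord {q : ℝ} (hq₀ : 0 ≤ q) (hq₁ : q ≤ 1) {d : ℕ} (hd : 0 < d) :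
    (1 - q / (d : ℝ)) ^ d ≤ 1 - q + q * (1 - 1 / (d : ℝ)) ^ d := by
  have hd' : (1 : ℝ) ≤ d := by exact_mod_cast hd
  have hv : 0 ≤ 1 - 1 / (d : ℝ) := sub_nonneg.2 ((div_le_one (by linarith)).2 hd')
  have h := (convexOn_pow (𝕜 := ℝ) d).2 (Set.mem_Ici.2 zero_le_one) (Set.mem_Ici.2 hv)
    (sub_nonneg.2 hq₁) hq₀ (by ring)
  simp only [smul_eq_mul, one_pow, mul_one] at h
  rwa [show 1 - q + q * (1 - 1 / (d : ℝ)) = 1 - q / d by ring] at h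

theorem zeta_convex_in_muC (p : ℝ) (hp : p ∈ Set.Ioo (0 : ℝ) 1)
    (d : ℕ) (hd : 0 < d) :
    (∀ μA ∈ Set.Icc (0 : ℝ) 1,
      ConvexOn ℝ (Set.Icc (0 : ℝ) (1 - μA))
        (fun μC : ℝ => zeta p d μA (1 - μA - μC) μC)) ∧
    (∀ μB ∈ Set.Icc (0 : ℝ) 1,
      ConvexOn ℝ (Set.Icc (0 : ℝ) (1 - μB))
        (fun μC : ℝ => zeta p d (1 - μB - μC) μB μC)) := by
  obtain ⟨hp₀, hp₁⟩ := hp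
  have hd' : (1 : ℝ) ≤ d := by exact_mod_cast hd
  have hd₀ : (0 : ℝ) < d := by linarith
  have hv₀ : 0 ≤ 1 - 1 / (d : ℝ) := sub_nonneg.2 ((div_le_one hd₀).2 hd')
  have hv₁ : (1 - 1 / (d : ℝ)) ^ d ≤ 1 :=
    pow_le_one₀ hv₀ (sub_le_self _ (by positivity))
  have hvu : (1 - 1 / (d : ℝ)) ^ d ≤ (1 - (1 - p) / (d : ℝ)) ^ d := by
    gcongr
    linarith
  have hchord := one_sub_div_pow_le_chord (sub_nonneg.2 hp₁.le) (by linarith : 1 - p ≤ 1) hd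
  have hr₁ : (1 - p) ^ d ≤ 1 - p :=
    pow_le_of_le_one (by linarith) (by linarith) hd.ne'
  have he₀ : 0 < Real.exp (p - 1) := Real.exp_pos _
  have he₁ : Real.exp (p - 1) ≤ 1 := Real.exp_le_one_iff.2 (by linarith)
  have hv : 0 ≤ (1 - 1 / (d : ℝ)) ^ d := pow_nonneg hv₀ d
  unfold zeta
  generalize (1 - 1 / (d : ℝ)) ^ d = v at *
  generalize (1 - (1 - p) / (d : ℝ)) ^ d = u at *
  generalize (1 - p) ^ d = r at *
  generalize Real.exp (p - 1) = e at *
  refine ⟨fun μA hA => ?_, fun μB hB => ?_⟩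
  · obtain ⟨hA₀, hA₁⟩ := hA
    set T := 1 - μA + μA * u with hT
    set Q := r * (1 - μA + μA * v) with hQ
    have hQT : Q ≤ T := by
      have h₁ : 0 ≤ 1 - μA + μA * v := add_nonneg (by linarith) (by positivity)
      have h₂ := mul_le_mul_of_nonneg_right (hr₁.trans (by linarith : 1 - p ≤ 1)) h₁
      have h₃ := mul_le_mul_of_nonneg_left hvu hA₀
      linarith
    have ha : 0 ≤ (1 - p) * (1 - e) * (T - Q) :=
      mul_nonneg (mul_nonneg (by linarith) (by linarith)) (by linarith)
    have hE : ∀ x, 1 - (1 - μA - x) + e * (1 - μA - x)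
        = (1 - (1 - e) * (1 - μA)) + (1 - e) * x := fun x => by ring
    set k := 1 - (1 - e) * (1 - μA)
    convert convexOn_quadratic (convex_Icc (0 : ℝ) (1 - μA)) ha
      (b := (1 - e) * (T / 2 + Q) + k * (1 - p) * (T - Q))
      (c := 1 + T / 2 + k * T / 2 + k * Q) using 2 with x
    simp only [hE]
    ring
  · obtain ⟨hB₀, hB₁⟩ := hB
    set E := 1 - μB + e * μB
    have hE₀ : 0 ≤ E := add_nonneg (by linarith) (by positivity)
    have hslope : r * (1 - v) ≤ 1 - u := by
      have h := mul_le_mul_of_nonneg_right hr₁ (sub_nonneg.2 hv₁)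
      linarith
    have ha : 0 ≤ (1 - p) * E * ((1 - u) - r * (1 - v)) :=
      mul_nonneg (mul_nonneg (by linarith) hE₀) (by linarith)
    have hT : ∀ x w, 1 - (1 - μB - x) + (1 - μB - x) * w
        = (1 - (1 - w) * (1 - μB)) + (1 - w) * x := fun x w => by ring
    set m := 1 - (1 - u) * (1 - μB)
    set n := 1 - (1 - v) * (1 - μB)
    convert convexOn_quadratic (convex_Icc (0 : ℝ) (1 - μB)) ha
      (b := (1 - u) * (1 + E) / 2 + E * r * (1 - v) + (1 - p) * E * (m - r * n))
      (c := 1 + m / 2 + E * m / 2 + E * r * n) using 2 with x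
    simp only [hT]
    ring
end

section
/- For every p ∈ (0,1) and every positive integer d, the supremum of ψ(p,d,μ_A,μ_B,μ_C) over the simplex {μ_A, μ_B, μ_C ≥ 0, μ_A + μ_B + μ_C = 1} is attained at some point with μ_C = 0; i.e., there exist μ_A', μ_B' ≥ 0 with μ_A' + μ_B' = 1 such that ψ(p,d,μ_A',μ_B',0) ≥ ψ(p,d,μ_A,μ_B,μ_C) for all feasible (μ_A,μ_B,μ_C). -/
/-- The decrease of `zeta`, per unit of mass moved from `μC` to `μA`, is at most `2`.
Here `t = (1 - q / d) ^ d`, `r = q ^ d` and `v = (1 - 1 / d) ^ d`. -/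
lemma exchange_rate_le_two {q t r v a E : ℝ} (hq0 : 0 ≤ q) (hq1 : q ≤ 1)
    (hqt : 1 - q ≤ t) (ht0 : 0 ≤ t) (hr0 : 0 ≤ r) (hrq : r ≤ q)
    (hv0 : 0 ≤ v) (ha0 : 0 ≤ a) (ha1 : a ≤ 1) (hE0 : 0 ≤ E) (hE1 : E ≤ 1) :
    (1 + E) / 2 * (1 - t) + q * E * ((1 - a + a * t) - r * (1 - a + a * v))
      + E * (r * (1 - v)) ≤ 2 := by
  have hrv : 0 ≤ r * v := mul_nonneg hr0 hv0
  have hzero : (1 - t) + q * (1 - r) + r * (1 - v) ≤ 2 := by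
    nlinarith [mul_nonneg (sub_nonneg.2 hq1) (sub_nonneg.2 hrq),
      mul_nonneg (sub_nonneg.2 hq1) (sub_nonneg.2 hq1)]
  have hone : (1 - t) + q * (t - r * v) + r * (1 - v) ≤ 2 := by
    nlinarith [mul_nonneg (sub_nonneg.2 hq1) ht0, mul_nonneg hq0 hrv]
  have hE_one : (1 - t) + q * ((1 - a + a * t) - r * (1 - a + a * v)) + r * (1 - v) ≤ 2 := by
    nlinarith [mul_nonneg (sub_nonneg.2 ha1) (sub_nonneg.2 hzero),
      mul_nonneg ha0 (sub_nonneg.2 hone)]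
  have hE_zero : (1 - t) / 2 ≤ 2 := by linarith
  nlinarith [mul_nonneg hE0 (sub_nonneg.2 hE_one),
    mul_nonneg (sub_nonneg.2 hE1) (sub_nonneg.2 hE_zero)]

lemma zeta_le_zeta_exchange {p : ℝ} (hp : p ∈ Set.Ioo (0 : ℝ) 1) {d : ℕ} (hd : 0 < d)
    {a b c : ℝ} (ha : 0 ≤ a) (hb : 0 ≤ b) (hc : 0 ≤ c) (habc : a + b + c = 1) :
    zeta p d a b c ≤ zeta p d (a + c) b 0 + 2 * c := by
  obtain ⟨hp0, hp1⟩ := hp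
  have hd1 : (1 : ℝ) ≤ d := by exact_mod_cast hd
  have hd0 : (0 : ℝ) < d := by linarith
  have hinv1 : 1 / (d : ℝ) ≤ 1 := (div_le_one hd0).2 hd1
  have hqd : (1 - p) / (d : ℝ) ≤ 1 := (div_le_one hd0).2 (by linarith)
  have hbern : 1 - (1 - p) ≤ (1 - (1 - p) / (d : ℝ)) ^ d := by
    have h := one_add_mul_le_pow (a := -((1 - p) / (d : ℝ))) (by linarith) d
    have hmul : (d : ℝ) * -((1 - p) / d) = -(1 - p) := by field_simp
    rw [hmul] at h
    simpa [sub_eq_add_neg] using h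
  have he0 : 0 < Real.exp (p - 1) := Real.exp_pos _
  have he1 : Real.exp (p - 1) ≤ 1 := Real.exp_le_one_iff.2 (by linarith)
  have hrate := exchange_rate_le_two (q := 1 - p) (v := (1 - 1 / (d : ℝ)) ^ d) (a := a)
    (E := 1 - b + Real.exp (p - 1) * b) (by linarith) (by linarith) hbern
    (pow_nonneg (by linarith) d) (pow_nonneg (by linarith) d)
    (pow_le_of_le_one (by linarith) (by linarith) hd.ne')
    (pow_nonneg (by linarith) d) ha (by linarith) (by nlinarith) (by nlinarith)
  have h := mul_le_mul_of_nonneg_left hrate hc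
  simp only [zeta]
  linarith

lemma one_le_psi_one_zero_zero {p : ℝ} (hp : p ∈ Set.Ioo (0 : ℝ) 1) {d : ℕ} (hd : 0 < d) :
    1 ≤ psi p d 1 0 0 := by
  obtain ⟨hp0, hp1⟩ := hp
  have hd1 : (1 : ℝ) ≤ d := by exact_mod_cast hd
  have hd0 : (0 : ℝ) < d := by linarith
  have hinv1 : 1 / (d : ℝ) ≤ 1 := (div_le_one hd0).2 hd1
  have hqd : (1 - p) / (d : ℝ) ≤ 1 := (div_le_one hd0).2 (by linarith)
  have ht : 0 ≤ (1 - (1 - p) / (d : ℝ)) ^ d := pow_nonneg (by linarith) d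
  have hrv : 0 ≤ (1 - p) ^ d * (1 - 1 / (d : ℝ)) ^ d :=
    mul_nonneg (pow_nonneg (by linarith) d) (pow_nonneg (by linarith) d)
  simp only [psi, zeta]
  norm_num at hrv ⊢
  linarith

lemma continuousOn_psi_edge (p : ℝ) (d : ℕ) :
    ContinuousOn (fun x : ℝ => psi p d x (1 - x) 0) (Set.Icc 0 1) := by
  unfold psi zeta
  refine ContinuousOn.div (by fun_prop) (by fun_prop) fun x hx => ?_
  have := hx.2
  norm_num
  linarith

theorem psi_max_at_muC_zero (p : ℝ) (hp : p ∈ Set.Ioo (0 : ℝ) 1)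
    (d : ℕ) (hd : 0 < d) :
    ∃ μA' μB' : ℝ, 0 ≤ μA' ∧ 0 ≤ μB' ∧ μA' + μB' = 1 ∧
      ∀ μA μB μC : ℝ, 0 ≤ μA → 0 ≤ μB → 0 ≤ μC → μA + μB + μC = 1 →
        psi p d μA μB μC ≤ psi p d μA' μB' 0 := by
  obtain ⟨x, hx, hmax⟩ := isCompact_Icc.exists_isMaxOn
    (Set.nonempty_Icc.2 zero_le_one) (continuousOn_psi_edge p d)
  refine ⟨x, 1 - x, hx.1, by linarith [hx.2], by ring, fun a b c ha hb hc habc => ?_⟩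
  have hM : 1 ≤ psi p d x (1 - x) 0 := by
    have h := hmax (Set.right_mem_Icc.2 zero_le_one)
    simp only [Set.mem_ofPred_eq, sub_self] at h
    exact (one_le_psi_one_zero_zero hp hd).trans h
  have hedge : psi p d (a + c) b 0 ≤ psi p d x (1 - x) 0 := by
    have h := hmax (show a + c ∈ Set.Icc (0 : ℝ) 1 from ⟨by linarith, by linarith⟩)
    simpa only [Set.mem_ofPred_eq, show 1 - (a + c) = b by linarith] using h
  have hexch := zeta_le_zeta_exchange hp hd ha hb hc habc
  generalize psi p d x (1 - x) 0 = M at hM hedge ⊢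
  rw [psi, div_le_iff₀ (by norm_num; linarith)] at hedge ⊢
  nlinarith
end

section
/- For every positive integer d and all reals μ_A, μ_B, μ_C ≥ 0 with μ_A + μ_B + μ_C = 1, one has ψ(p*, d, μ_A, μ_B, μ_C) ≤ α_alg. -/
theorem mul_denominator_sub_zeta_eq {q s t r e α A B C : ℝ} (hS : A + B + C = 1) :
    α * (A + 1.5 * B + 3 * C) -
      (1 + (1 - A + A * s) / 2 + (1 - B + e * B) * (1 - A + A * s) / 2
        + C * q * (1 - B + e * B) * (1 - A + A * s)
        + (1 - C * q) * (1 - B + e * B) * (r * (1 - A + A * t))) =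
    A * ((α - 1 - s - r * t) * A ^ 2
        + (3.5 * α - 4 - 1.5 * s - 0.5 * e * s - r * (1 + t + e * t)) * (A * B)
        + (4 * α - 4.5 - 0.5 * s - 0.5 * (e + e * s) - r * (1 + e + e * t)) * B ^ 2)
      + (5 * α - 4 - 2 * s - q * s - r * (1 + 2 * t - q * t)) * (A ^ 2 * C)
      + (11 * α - 9.5 - 1.5 * s - 0.5 * (e + e * s) - q * (1 + e * s)
          - r * (3 + t + e + e * t - q * (1 + e * t))) * (A * B * C)
      + (7 * α - 5 - s - q * (1 + s) - r * (2 + t - q * (1 + t))) * (A * C ^ 2)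
      + (1.5 * α - 1.5 - 0.5 * e - r * e) * B ^ 3
      + (6 * α - 5 - e - q * e - r * (1 + 2 * e - q * e)) * (B ^ 2 * C)
      + (7.5 * α - 5.5 - 0.5 * e - q * (1 + e) - r * (2 + e - q * (1 + e))) * (B * C ^ 2)
      + (3 * α - 2 - q - r * (1 - q)) * C ^ 3 := by
  obtain rfl : C = 1 - A - B := by linarith
  ring

theorem zeta_form_le {q s t r e α A B C : ℝ} (hA : 0 ≤ A) (hB : 0 ≤ B) (hC : 0 ≤ C)
    (hS : A + B + C = 1) (hq0 : 0 ≤ q) (hq : q ≤ 0.784) (hs0 : 0 ≤ s) (hs : s ≤ 0.457)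
    (ht0 : 0 ≤ t) (ht : t ≤ 0.368) (hr0 : 0 ≤ r) (hr : r ≤ 0.784) (he0 : 0 ≤ e)
    (he : e ≤ 0.457) (hα : 1.5458 ≤ α)
    (hAB : 0 ≤ (α - 1 - s - r * t) * A ^ 2
        + (3.5 * α - 4 - 1.5 * s - 0.5 * e * s - r * (1 + t + e * t)) * (A * B)
        + (4 * α - 4.5 - 0.5 * s - 0.5 * (e + e * s) - r * (1 + e + e * t)) * B ^ 2) :
    1 + (1 - A + A * s) / 2 + (1 - B + e * B) * (1 - A + A * s) / 2
        + C * q * (1 - B + e * B) * (1 - A + A * s)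
        + (1 - C * q) * (1 - B + e * B) * (r * (1 - A + A * t)) ≤
      α * (A + 1.5 * B + 3 * C) := by
  have mul_bound {x y a b : ℝ} (hx : x ≤ a) (hy0 : 0 ≤ y) (hy : y ≤ b) (ha : 0 ≤ a) :
      x * y ≤ a * b := mul_le_mul hx hy hy0 ha
  have hes0 : 0 ≤ e * s := by positivity
  have het0 : 0 ≤ e * t := by positivity
  have hes := mul_bound he hs0 hs (by norm_num)
  have het := mul_bound he ht0 ht (by norm_num)
  have hqs := mul_bound hq hs0 hs (by norm_num)
  have hqe := mul_bound hq he0 he (by norm_num)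
  have hqes := mul_bound hq hes0 hes (by norm_num)
  have hrt := mul_bound hr ht0 ht (by norm_num)
  have hre := mul_bound hr he0 he (by norm_num)
  have hret := mul_bound hr het0 het (by norm_num)
  have hrq0 : 0 ≤ r * q := by positivity
  have hrqt0 : 0 ≤ r * q * t := by positivity
  have hrqe0 : 0 ≤ r * q * e := by positivity
  have hrqet0 : 0 ≤ r * q * (e * t) := by positivity
  have hAAC : 0 ≤ 5 * α - 4 - 2 * s - q * s - r * (1 + 2 * t - q * t) := by linarith
  have hABC : 0 ≤ 11 * α - 9.5 - 1.5 * s - 0.5 * (e + e * s) - q * (1 + e * s)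
          - r * (3 + t + e + e * t - q * (1 + e * t)) := by linarith
  have hACC : 0 ≤ 7 * α - 5 - s - q * (1 + s) - r * (2 + t - q * (1 + t)) := by linarith
  have hBBB : 0 ≤ 1.5 * α - 1.5 - 0.5 * e - r * e := by linarith
  have hBBC : 0 ≤ 6 * α - 5 - e - q * e - r * (1 + 2 * e - q * e) := by linarith
  have hBCC : 0 ≤ 7.5 * α - 5.5 - 0.5 * e - q * (1 + e) - r * (2 + e - q * (1 + e)) := by
    linarith
  have hCCC : 0 ≤ 3 * α - 2 - q - r * (1 - q) := by linarith
  rw [← sub_nonneg, mul_denominator_sub_zeta_eq hS]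
  positivity

theorem binary_form_nonneg {s t r e α A B : ℝ} (hA : 0 ≤ A) (hB : 0 ≤ B) (hs0 : 0 ≤ s)
    (hs : s ≤ 0.457) (ht0 : 0 ≤ t) (ht : t ≤ 0.368) (hr0 : 0 ≤ r)
    (hr : r ≤ 0.45 + 0.27 * (r * t)) (he0 : 0 ≤ e) (he : e ≤ 0.457) (hα : 1.5458 ≤ α)
    (h : 1 + s + r * t ≤ α) :
    0 ≤ (α - 1 - s - r * t) * A ^ 2
        + (3.5 * α - 4 - 1.5 * s - 0.5 * e * s - r * (1 + t + e * t)) * (A * B)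
        + (4 * α - 4.5 - 0.5 * s - 0.5 * (e + e * s) - r * (1 + e + e * t)) * B ^ 2 := by
  have hrt0 : 0 ≤ r * t := by positivity
  have hes : e * s ≤ 0.457 * s := by gcongr
  have het : e * (r * t) ≤ 0.457 * (r * t) := by gcongr
  have hr' : r ≤ 0.5 := by nlinarith
  have hrt : r * t ≤ 0.5 * 0.368 := by gcongr
  have hre : r * e ≤ 0.5 * 0.457 := by gcongr
  have hAA : 0 ≤ α - 1 - s - r * t := by linarith
  have hAB : 0 ≤ 3.5 * α - 4 - 1.5 * s - 0.5 * e * s - r * (1 + t + e * t) := by linarith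
  have hBB : 0 ≤ 4 * α - 4.5 - 0.5 * s - 0.5 * (e + e * s) - r * (1 + e + e * t) := by
    linarith
  positivity

theorem one_sub_pstar_bounds : 0.7836 < 1 - pstar ∧ 1 - pstar < 0.78362 := by
  have h0 : (1.41421 : ℝ) < √2 := Real.lt_sqrt_of_sq_lt (by norm_num)
  have h1 : √2 < (1.41422 : ℝ) := (Real.sqrt_lt' (by norm_num)).2 (by norm_num)
  unfold pstar
  constructor <;> linarith

theorem alphaAlg_lower_bound : 1.5458 ≤ alphaAlg := by
  have h1 : √2 < (1.41422 : ℝ) := (Real.sqrt_lt' (by norm_num)).2 (by norm_num)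
  have h2 : √2 ^ 2 = (2 : ℝ) := Real.sq_sqrt (by norm_num)
  have h : alphaAlg = 1 + (72 - 32 * √2) / 49 := by
    unfold alphaAlg g pstar
    push_cast
    linear_combination 8 / 49 * √2 * h2
  rw [h]
  linarith

theorem exp_pstar_sub_one_le : Real.exp (pstar - 1) ≤ 0.457 := by
  have hq := one_sub_pstar_bounds.1
  have h := Real.sum_le_exp_of_nonneg (x := 0.7836) (by norm_num) 6
  have h' : Real.exp (pstar - 1) ≤ (Real.exp 0.7836)⁻¹ := by
    rw [← Real.exp_neg]
    exact Real.exp_le_exp.2 (by linarith)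
  refine h'.trans (inv_le_of_inv_le₀ (by norm_num) (h.trans' ?_))
  norm_num [Finset.sum_range_succ, Nat.factorial]

theorem one_sub_div_pow_le_exp_neg_one {d : ℕ} (hd : 0 < d) :
    (1 - 1 / (d : ℝ)) ^ d ≤ 0.368 := by
  have h := Real.one_sub_div_pow_le_exp_neg (n := d) (t := 1) (by exact_mod_cast hd)
  exact h.trans (by linarith [Real.exp_neg_one_lt_d9])

theorem one_sub_one_sub_pstar_div_pow_le {d : ℕ} (hd : 0 < d) :
    (1 - (1 - pstar) / (d : ℝ)) ^ d ≤ 0.457 := by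
  have hd' : (1 : ℝ) ≤ d := by exact_mod_cast hd
  have h := Real.one_sub_div_pow_le_exp_neg (n := d) (t := 1 - pstar)
    (by linarith [one_sub_pstar_bounds.2])
  rw [neg_sub] at h
  exact h.trans exp_pstar_sub_one_le

theorem binary_form_nonneg_at_pstar {d : ℕ} (hd : 0 < d) {A B : ℝ} (hA : 0 ≤ A) (hB : 0 ≤ B) :
    let q := 1 - pstar
    let s := (1 - q / (d : ℝ)) ^ d
    let t := (1 - 1 / (d : ℝ)) ^ d
    let r := q ^ d
    let e := Real.exp (pstar - 1)
    0 ≤ (alphaAlg - 1 - s - r * t) * A ^ 2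
        + (3.5 * alphaAlg - 4 - 1.5 * s - 0.5 * e * s - r * (1 + t + e * t)) * (A * B)
        + (4 * alphaAlg - 4.5 - 0.5 * s - 0.5 * (e + e * s) - r * (1 + e + e * t)) * B ^ 2 := by
  intro q s t r e
  obtain ⟨hq0, hq1⟩ : 0.7836 < q ∧ q < 0.78362 := one_sub_pstar_bounds
  have hα := alphaAlg_lower_bound
  have he0 : 0 ≤ e := (Real.exp_pos _).le
  have he : e ≤ 0.457 := exp_pstar_sub_one_le
  have hd1 : (1 : ℝ) ≤ d := by exact_mod_cast hd
  have hs0 : 0 ≤ s := pow_nonneg (by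
    rw [sub_nonneg, div_le_one (by linarith)]
    linarith) d
  have hs : s ≤ 0.457 := one_sub_one_sub_pstar_div_pow_le hd
  have ht0 : 0 ≤ t := pow_nonneg (by
    rw [sub_nonneg, div_le_one (by linarith)]
    linarith) d
  have ht : t ≤ 0.368 := one_sub_div_pow_le_exp_neg_one hd
  have hr0 : 0 ≤ r := pow_nonneg (by linarith) d
  have pow_bound (n : ℕ) : q ^ n ≤ 0.78362 ^ n := pow_le_pow_left₀ (by linarith) hq1.le n
  have base_bound (n : ℕ) (hn : 1 ≤ n) : (1 - q / (n : ℝ)) ^ n ≤ (1 - 0.7836 / (n : ℝ)) ^ n := by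
    have hn' : (1 : ℝ) ≤ n := by exact_mod_cast hn
    refine pow_le_pow_left₀ ?_ (by gcongr) n
    rw [sub_nonneg, div_le_one (by linarith)]
    linarith
  rcases (show d = 1 ∨ d = 2 ∨ d = 3 ∨ d = 4 ∨ d = 5 ∨ 6 ≤ d by lia) with
    rfl | rfl | rfl | rfl | rfl | h6
  · have hs' : s ≤ 0.2164 := (base_bound 1 le_rfl).trans (by norm_num)
    have hr' : r ≤ 0.78362 := by simpa [r] using hq1.le
    have ht' : t = 0 := by simp [t]
    have hes : e * s ≤ 0.457 * 0.2164 := by gcongr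
    have hre : r * e ≤ 0.78362 * 0.457 := by gcongr
    rw [ht']
    have hAA : 0 ≤ alphaAlg - 1 - s - r * 0 := by linarith
    have hAB : 0 ≤ 3.5 * alphaAlg - 4 - 1.5 * s - 0.5 * e * s - r * (1 + 0 + e * 0) := by
      linarith
    have hBB : 0 ≤ 4 * alphaAlg - 4.5 - 0.5 * s - 0.5 * (e + e * s) - r * (1 + e + e * 0) := by
      linarith
    positivity
  · have hs' : s ≤ 0.37 := (base_bound 2 (by norm_num)).trans (by norm_num)
    have hr' : r ≤ 0.6141 := (pow_bound 2).trans (by norm_num)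
    have ht' : t = 0.25 := by norm_num [t]
    have hes : e * s ≤ 0.457 * 0.37 := by gcongr
    have hre : r * e ≤ 0.6141 * 0.457 := by gcongr
    rw [ht']
    have hAA : 0.02 ≤ alphaAlg - 1 - s - r * 0.25 := by linarith
    have hAB : -0.08 ≤ 3.5 * alphaAlg - 4 - 1.5 * s - 0.5 * e * s - r * (1 + 0.25 + e * 0.25) := by
      linarith
    have hBB : 0.2 ≤ 4 * alphaAlg - 4.5 - 0.5 * s - 0.5 * (e + e * s)
        - r * (1 + e + e * 0.25) := by
      linarith
    calc (0 : ℝ) ≤ 0.02 * A ^ 2 + -0.08 * (A * B) + 0.2 * B ^ 2 := by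
          nlinarith [sq_nonneg (A - 2 * B), sq_nonneg B]
      _ ≤ _ := by gcongr
  · have hr' : r ≤ 0.4812 := (pow_bound 3).trans (by norm_num)
    have hr'' : 0.481 ≤ r :=
      le_trans (by norm_num) (pow_le_pow_left₀ (by norm_num) hq0.le 3)
    have ht' : t = 8 / 27 := by norm_num [t]
    refine binary_form_nonneg hA hB hs0 hs ht0 ht hr0 ?_ he0 he hα ?_
    · rw [ht']; linarith
    · refine le_of_eq ?_
      simp only [alphaAlg, g, s, r, t, mul_pow, q]
  · have hs' : s ≤ 0.4182 := (base_bound 4 (by norm_num)).trans (by norm_num)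
    have hr' : r ≤ 0.3771 := (pow_bound 4).trans (by norm_num)
    have ht' : t = 81 / 256 := by norm_num [t]
    refine binary_form_nonneg hA hB hs0 hs ht0 ht hr0 ?_ he0 he hα ?_ <;> rw [ht'] <;> linarith
  · have hs' : s ≤ 0.4267 := (base_bound 5 (by norm_num)).trans (by norm_num)
    have hr' : r ≤ 0.2956 := (pow_bound 5).trans (by norm_num)
    have ht' : t = 1024 / 3125 := by norm_num [t]
    refine binary_form_nonneg hA hB hs0 hs ht0 ht hr0 ?_ he0 he hα ?_ <;> rw [ht'] <;> linarith
  · have hr' : r ≤ 0.2316 :=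
      (pow_le_pow_of_le_one (by linarith) (by linarith) h6).trans
        ((pow_bound 6).trans (by norm_num))
    have hrt0 : 0 ≤ r * t := mul_nonneg hr0 ht0
    have hrt : r * t ≤ 0.2316 * 0.368 := by gcongr
    exact binary_form_nonneg hA hB hs0 hs ht0 ht hr0 (by linarith) he0 he hα (by linarith)

theorem psi_le_alphaAlg (d : ℕ) (hd : 0 < d) :
    ∀ μA μB μC : ℝ, 0 ≤ μA → 0 ≤ μB → 0 ≤ μC → μA + μB + μC = 1 →
      psi pstar d μA μB μC ≤ alphaAlg := by
  intro A B C hA hB hC hS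
  obtain ⟨hq0, hq1⟩ := one_sub_pstar_bounds
  have hd1 : (1 : ℝ) ≤ d := by exact_mod_cast hd
  have h := zeta_form_le (q := 1 - pstar) hA hB hC hS (by linarith) (by linarith)
    (pow_nonneg (by
      rw [sub_nonneg, div_le_one (by linarith)]
      linarith) d)
    (one_sub_one_sub_pstar_div_pow_le hd)
    (pow_nonneg (by
      rw [sub_nonneg, div_le_one (by linarith)]
      linarith) d)
    (one_sub_div_pow_le_exp_neg_one hd)
    (pow_nonneg (by linarith) d)
    ((pow_le_of_le_one (by linarith) (by linarith) hd.ne').trans (by linarith))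
    (Real.exp_pos _).le exp_pstar_sub_one_le alphaAlg_lower_bound
    (binary_form_nonneg_at_pstar hd hA hB)
  unfold psi
  rw [div_le_iff₀ (by linarith)]
  refine le_trans (le_of_eq ?_) h
  simp only [zeta]
end

section
/- Let d_A, d_B ≥ 1 be integers, ℓ = d_A + d_B, let ε ≥ 0, let γ_1,…,γ_ℓ be arbitrary reals and μ_1,…,μ_ℓ strictly positive reals. Consider the polytope P of vectors (s_1,…,s_ℓ) ∈ ℝ^ℓ satisfying: s_1 ≥ 0, ∑_{i=1}^ℓ μ_i s_i = 1, s_1 ≤ s_2 ≤ … ≤ s_{d_A} ≤ 1.5·s_1, and 1.5·s_1 ≤ s_{d_A+1} ≤ … ≤ s_ℓ ≤ 3(1+ε)·s_1. If P is nonempty, then the maximum of the linear objective ∑_{i=1}^ℓ γ_i s_i over P is attained, and it is attained at some point s* ∈ P such that every coordinate satisfies s*_i ∈ {s*_1, 1.5·s*_1, 3(1+ε)·s*_1}. -/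
/-- The cone of vectors whose first `dA` coordinates increase from `s z` to at most `1.5 * s z`, and
whose remaining coordinates increase from at least `1.5 * s z` to at most `K * s z`. -/
def twoBlockCone (dA dB : ℕ) (K : ℝ) (z : Fin (dA + dB)) : Set (Fin (dA + dB) → ℝ) :=
  {s | 0 ≤ s z ∧
    (∀ i j : Fin (dA + dB), (i : ℕ) ≤ (j : ℕ) → (j : ℕ) < dA → s i ≤ s j) ∧
    (∀ i : Fin (dA + dB), (i : ℕ) < dA → s i ≤ 1.5 * s z) ∧
    (∀ i : Fin (dA + dB), dA ≤ (i : ℕ) → 1.5 * s z ≤ s i) ∧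
    (∀ i j : Fin (dA + dB), (i : ℕ) ≤ (j : ℕ) → dA ≤ (i : ℕ) → s i ≤ s j) ∧
    (∀ i : Fin (dA + dB), dA ≤ (i : ℕ) → s i ≤ K * s z)}

namespace twoBlockCone

variable {dA dB : ℕ} {K : ℝ} {z : Fin (dA + dB)} {s : Fin (dA + dB) → ℝ}

theorem isClosed : IsClosed (twoBlockCone dA dB K z) := by
  simp only [twoBlockCone, Set.ofPred_and, Set.ofPred_forall]
  refine IsClosed.inter ?_ (IsClosed.inter ?_ (IsClosed.inter ?_ (IsClosed.inter ?_
    (IsClosed.inter ?_ ?_))))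
  · exact isClosed_le (by fun_prop) (by fun_prop)
  all_goals
    repeat refine isClosed_iInter fun _ => ?_
    exact isClosed_le (by fun_prop) (by fun_prop)

theorem smul_mem (hs : s ∈ twoBlockCone dA dB K z) {c : ℝ} (hc : 0 ≤ c) :
    c • s ∈ twoBlockCone dA dB K z := by
  obtain ⟨h0, h1, h2, h3, h4, h5⟩ := hs
  refine ⟨mul_nonneg hc h0, fun i j hij hj => mul_le_mul_of_nonneg_left (h1 i j hij hj) hc,
    fun i hi => ?_, fun i hi => ?_,
    fun i j hij hi => mul_le_mul_of_nonneg_left (h4 i j hij hi) hc, fun i hi => ?_⟩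
  · simpa [mul_left_comm] using mul_le_mul_of_nonneg_left (h2 i hi) hc
  · simpa [mul_left_comm] using mul_le_mul_of_nonneg_left (h3 i hi) hc
  · simpa [mul_left_comm] using mul_le_mul_of_nonneg_left (h5 i hi) hc

theorem base_le (hz : (z : ℕ) = 0) (hs : s ∈ twoBlockCone dA dB K z) (i : Fin (dA + dB)) :
    s z ≤ s i := by
  obtain ⟨h0, h1, -, h3, -, -⟩ := hs
  rcases lt_or_ge (i : ℕ) dA with hi | hi
  · exact h1 z i (by omega) hi
  · linarith [h3 i hi]

theorem nonneg (hz : (z : ℕ) = 0) (hs : s ∈ twoBlockCone dA dB K z) (i : Fin (dA + dB)) :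
    0 ≤ s i :=
  hs.1.trans (base_le hz hs i)

theorem base_pos (hz : (z : ℕ) = 0) (hs : s ∈ twoBlockCone dA dB K z) (hne : s ≠ 0) :
    0 < s z := by
  refine lt_of_le_of_ne hs.1 fun h => hne (funext fun i => le_antisymm ?_ (nonneg hz hs i))
  obtain ⟨-, -, h2, -, -, h5⟩ := hs
  rcases lt_or_ge (i : ℕ) dA with hi | hi
  · simpa [← h] using h2 i hi
  · simpa [← h] using h5 i hi

end twoBlockCone

open Filter Topology in
theorem eventually_add_mul_le {a b p q : ℝ} (hab : a ≤ b) (heq : a = b → p = q) :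
    ∀ᶠ η in 𝓝 (0 : ℝ), a + η * p ≤ b + η * q := by
  rcases hab.eq_or_lt with h | h
  · simp [h, heq h]
  · have hl : Tendsto (fun η : ℝ => a + η * p) (𝓝 0) (𝓝 a) :=
      Continuous.tendsto' (by fun_prop) _ _ (by simp)
    have hr : Tendsto (fun η : ℝ => b + η * q) (𝓝 0) (𝓝 b) :=
      Continuous.tendsto' (by fun_prop) _ _ (by simp)
    exact (hl.eventually_lt hr h).mono fun _ => le_of_lt

open Filter Topology in
/-- Moving a full level set of `s`, at a height other than the three bounds, stays in the cone. -/
theorem twoBlockCone.eventually_add_levelSet_mem {dA dB : ℕ} {K : ℝ} {z : Fin (dA + dB)}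
    {s : Fin (dA + dB) → ℝ} (hs : s ∈ twoBlockCone dA dB K z) {v : ℝ}
    (hv0 : v ≠ s z) (hv1 : v ≠ 1.5 * s z) (hv2 : v ≠ K * s z) :
    ∀ᶠ η in 𝓝 (0 : ℝ), (s + η • fun i => if s i = v then (1 : ℝ) else 0) ∈
      twoBlockCone dA dB K z := by
  obtain ⟨h0, h1, h2, h3, h4, h5⟩ := hs
  simp only [twoBlockCone, Set.mem_ofPred_eq, Pi.add_apply, Pi.smul_apply, smul_eq_mul,
    if_neg hv0.symm, mul_zero, add_zero, eventually_and, eventually_all]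
  refine ⟨.of_forall fun _ => h0, fun i j hij hj => ?_, fun i hi => ?_, fun i hi => ?_,
    fun i j hij hi => ?_, fun i hi => ?_⟩
  · exact eventually_add_mul_le (h1 i j hij hj) fun h => by rw [h]
  · simpa using eventually_add_mul_le (p := if s i = v then 1 else 0) (q := 0) (h2 i hi)
      fun h => by rw [h, if_neg hv1.symm]
  · simpa using eventually_add_mul_le (p := 0) (q := if s i = v then 1 else 0) (h3 i hi)
      fun h => by rw [← h, if_neg hv1.symm]
  · exact eventually_add_mul_le (h4 i j hij hi) fun h => by rw [h]
  · simpa using eventually_add_mul_le (p := if s i = v then 1 else 0) (q := 0) (h5 i hi)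
      fun h => by rw [h, if_neg hv2.symm]

theorem twoBlockCone.isCompact_slice {dA dB : ℕ} {K : ℝ} {z : Fin (dA + dB)} (hz : (z : ℕ) = 0)
    {μ : Fin (dA + dB) → ℝ} (hμ : ∀ i, 0 < μ i) :
    IsCompact (twoBlockCone dA dB K z ∩ {s | ∑ i, μ i * s i = 1}) := by
  refine (isCompact_Icc (a := 0) (b := fun i => 1 / μ i)).of_isClosed_subset
    (isClosed.inter (isClosed_eq (by fun_prop) (by fun_prop))) ?_
  rintro s ⟨hs, hsum⟩
  refine ⟨nonneg hz hs, fun i => ?_⟩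
  rw [le_div_iff₀' (hμ i), ← show ∑ i, μ i * s i = 1 from hsum]
  exact Finset.single_le_sum (f := fun i => μ i * s i)
    (fun j _ => mul_nonneg (hμ j).le (nonneg hz hs j)) (Finset.mem_univ i)

open Filter Topology in
theorem twoBlockCone.eq_of_mem_extremePoints_slice {dA dB : ℕ} {K : ℝ} {z : Fin (dA + dB)}
    (hz : (z : ℕ) = 0) {μ : Fin (dA + dB) → ℝ} (hμ : ∀ i, 0 < μ i) {s : Fin (dA + dB) → ℝ}
    (hs : s ∈ Set.extremePoints ℝ (twoBlockCone dA dB K z ∩ {s | ∑ i, μ i * s i = 1}))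
    (i : Fin (dA + dB)) : s i = s z ∨ s i = 1.5 * s z ∨ s i = K * s z := by
  by_contra! hv
  obtain ⟨⟨hcone, hsum⟩, hext⟩ := hs
  have hsum : ∑ j, μ j * s j = 1 := hsum
  have hpos : 0 < s z := base_pos hz hcone (by rintro rfl; simp at hsum)
  set b : Fin (dA + dB) → ℝ := fun j => if s j = s i then 1 else 0 with hb
  set m : ℝ := ∑ j, μ j * b j with hm
  have hm0 : 0 < m := by
    refine Finset.sum_pos' (fun j _ => mul_nonneg (hμ j).le ?_) ⟨i, Finset.mem_univ i, ?_⟩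
    · simp only [hb]; split_ifs <;> norm_num
    · simpa [hb] using hμ i
  have hev := eventually_add_levelSet_mem hcone hv.1 hv.2.1 hv.2.2
  have hlt : ∀ᶠ η in 𝓝 (0 : ℝ), 0 < 1 + η * m :=
    (Continuous.tendsto' (f := fun η : ℝ => 1 + η * m) (by fun_prop) 0 1
      (by simp)).eventually_const_lt one_pos
  have hboth := hev.and hlt
  have hneg : Tendsto (fun η : ℝ => -η) (𝓝 0) (𝓝 0) :=
    Continuous.tendsto' (by fun_prop) _ _ (by simp)
  obtain ⟨η, ⟨⟨hp, hp1⟩, hq, hq1⟩, hη⟩ :=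
    (((hboth.and (hneg.eventually hboth)).filter_mono nhdsWithin_le_nhds).and
      (self_mem_nhdsWithin : Set.Ioi (0 : ℝ) ∈ 𝓝[>] 0)).exists
  have hη : 0 < η := hη
  have slice : ∀ η : ℝ, s + η • b ∈ twoBlockCone dA dB K z → 0 < 1 + η * m →
      (1 + η * m)⁻¹ • (s + η • b) ∈
        twoBlockCone dA dB K z ∩ {s | ∑ i, μ i * s i = 1} := by
    intro η hmem hη
    refine ⟨smul_mem hmem (inv_nonneg.2 hη.le), ?_⟩
    have : ∑ j, μ j * (s j + η * b j) = 1 + η * m := by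
      rw [hm, ← hsum, Finset.mul_sum, ← Finset.sum_add_distrib]
      exact Finset.sum_congr rfl fun j _ => by ring
    simp only [Set.mem_ofPred_eq, Pi.smul_apply, Pi.add_apply, smul_eq_mul]
    simp only [mul_left_comm (μ _) _⁻¹, ← Finset.mul_sum, this, inv_mul_cancel₀ hη.ne']
  have heq := hext (slice η hp hp1) (slice (-η) hq hq1)
    ⟨(1 + η * m) / 2, (1 + -η * m) / 2, by positivity, by positivity, by ring, by
      rw [smul_smul, smul_smul, div_mul_eq_mul_div, div_mul_eq_mul_div,
        mul_inv_cancel₀ hp1.ne', mul_inv_cancel₀ hq1.ne']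
      module⟩
  have hzero := congrFun heq z
  simp only [Pi.smul_apply, Pi.add_apply, smul_eq_mul, hb, if_neg hv.1.symm, mul_zero,
    add_zero] at hzero
  rw [inv_mul_eq_iff_eq_mul₀ hp1.ne'] at hzero
  nlinarith [mul_pos (mul_pos hη hm0) hpos]

/-- A linear form on a nonempty compact set attains its maximum at an extreme point. -/
theorem IsCompact.exists_extremePoint_forall_le {E : Type*} [AddCommGroup E] [Module ℝ E]
    [TopologicalSpace E] [IsTopologicalAddGroup E] [ContinuousSMul ℝ E] [T2Space E]
    [LocallyConvexSpace ℝ E] {A : Set E} (hA : IsCompact A) (hne : A.Nonempty)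
    (f : StrongDual ℝ E) : ∃ x ∈ A.extremePoints ℝ, ∀ y ∈ A, f y ≤ f x := by
  obtain ⟨x₀, hx₀, hmax⟩ := hA.exists_isMaxOn hne f.continuous.continuousOn
  have hF : IsExposed ℝ A {x ∈ A | ∀ y ∈ A, f y ≤ f x} := fun _ => ⟨f, rfl⟩
  obtain ⟨x, hx⟩ := (hF.isCompact hA).extremePoints_nonempty ⟨x₀, hx₀, hmax⟩
  exact ⟨x, hF.isExtreme.extremePoints_subset_extremePoints hx, hx.1.2⟩


theorem lp_extreme_point_structure
    (dA dB : ℕ) (hdA : 1 ≤ dA) (hdB : 1 ≤ dB) (ε : ℝ) (hε : 0 ≤ ε)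
    (γ μ : Fin (dA + dB) → ℝ) (hμ : ∀ i, 0 < μ i)
    (P : Set (Fin (dA + dB) → ℝ))
    (hP : P = {s : Fin (dA + dB) → ℝ |
      0 ≤ s ⟨0, by omega⟩ ∧
      (∑ i, μ i * s i) = 1 ∧
      (∀ i j : Fin (dA + dB), (i : ℕ) ≤ (j : ℕ) → (j : ℕ) < dA → s i ≤ s j) ∧
      (∀ i : Fin (dA + dB), (i : ℕ) < dA → s i ≤ 1.5 * s ⟨0, by omega⟩) ∧
      (∀ i : Fin (dA + dB), dA ≤ (i : ℕ) → 1.5 * s ⟨0, by omega⟩ ≤ s i) ∧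
      (∀ i j : Fin (dA + dB), (i : ℕ) ≤ (j : ℕ) → dA ≤ (i : ℕ) → s i ≤ s j) ∧
      (∀ i : Fin (dA + dB), dA ≤ (i : ℕ) → s i ≤ 3 * (1 + ε) * s ⟨0, by omega⟩)})
    (hne : P.Nonempty) :
    ∃ sstar ∈ P,
      (∀ s ∈ P, (∑ i, γ i * s i) ≤ ∑ i, γ i * sstar i) ∧
      (∀ i : Fin (dA + dB),
        sstar i = sstar ⟨0, by omega⟩ ∨
        sstar i = 1.5 * sstar ⟨0, by omega⟩ ∨
        sstar i = 3 * (1 + ε) * sstar ⟨0, by omega⟩) := by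
  have hP' : P = twoBlockCone dA dB (3 * (1 + ε)) ⟨0, by omega⟩ ∩ {s | ∑ i, μ i * s i = 1} := by
    rw [hP]
    ext s
    simp only [twoBlockCone, Set.mem_inter_iff, Set.mem_ofPred_eq]
    tauto
  subst hP'
  obtain ⟨x, hx, hmax⟩ := (twoBlockCone.isCompact_slice rfl hμ).exists_extremePoint_forall_le hne
    (∑ i, γ i • ContinuousLinearMap.proj (R := ℝ) (φ := fun _ : Fin (dA + dB) => ℝ) i)
  refine ⟨x, hx.1, fun s hs => ?_, twoBlockCone.eq_of_mem_extremePoints_slice rfl hμ hx⟩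
  simpa using hmax s hs
end

section
/- For every integer d ≥ 3 there exists a probability distribution μ on the finite set Ω^d, where Ω = {1, 2, …, d-1}, such that (i) μ is pairwise independent with uniform marginals: for all indices 1 ≤ i < j ≤ d and all values t_i, t_j ∈ Ω, the probability under μ that the i-th coordinate equals t_i and the j-th coordinate equals t_j is exactly 1/(d-1)^2; and (ii) every tuple x ∈ Ω^d in the support of μ has at least one coordinate i ∈ {1,…,d} with x_i = 1. -/
/-- The total mass of a product of weight functions, each of total mass one. -/
theorem sum_prod_weights_eq_one {ι α : Type*} [Fintype ι] [DecidableEq ι] [Fintype α]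
    (w : ι → α → ℝ) (hw : ∀ i, ∑ t, w i t = 1) :
    ∑ x : ι → α, ∏ k, w k (x k) = 1 := by
  rw [← Fintype.piFinset_univ, Finset.sum_prod_piFinset]
  simp [hw]

/-- The two-coordinate marginals of a product of weight functions, each of total mass one. -/
theorem sum_filter_prod_weights {ι α : Type*} [Fintype ι] [DecidableEq ι] [Fintype α]
    [DecidableEq α] (w : ι → α → ℝ) (hw : ∀ i, ∑ t, w i t = 1) {i j : ι} (hij : i ≠ j)
    (a b : α) :
    ∑ x : ι → α with x i = a ∧ x j = b, ∏ k, w k (x k) = w i a * w j b := by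
  have hset : (Finset.univ.filter fun x : ι → α => x i = a ∧ x j = b) =
      Fintype.piFinset fun k => if k = i then {a} else if k = j then {b} else Finset.univ := by
    ext x
    simp only [Finset.mem_filter, Finset.mem_univ, true_and, Fintype.mem_piFinset]
    constructor
    · rintro ⟨rfl, rfl⟩ k
      split_ifs with h1 h2 <;> simp [*]
    · intro h
      have hi := h i
      have hj := h j
      simp [hij.symm] at hi hj
      exact ⟨hi, hj⟩
  rw [hset]
  rw [← Finset.prod_univ_sum]
  rw [Finset.prod_eq_mul i j hij]
  · simp [hij.symm]
  · rintro k - ⟨hi, hj⟩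
    simp [hi, hj, hw]
  · simp
  · simp

/-- Mass one at `z` on the distinguished coordinate, uniform on `α \ {z}` on the others. -/
noncomputable def singleHitWeight {ι α : Type*} [DecidableEq ι] [Fintype α] [DecidableEq α]
    (z : α) (k i : ι) (t : α) : ℝ :=
  if i = k then (if t = z then 1 else 0)
  else (if t = z then 0 else 1 / ((Fintype.card α : ℝ) - 1))

theorem sum_singleHitWeight {ι α : Type*} [DecidableEq ι] [Fintype α] [DecidableEq α]
    (hα : 2 ≤ Fintype.card α) (z : α) (k i : ι) : ∑ t, singleHitWeight z k i t = 1 := by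
  have hq : (2 : ℝ) ≤ Fintype.card α := by exact_mod_cast hα
  have hne : (Fintype.card α : ℝ) - 1 ≠ 0 := by linarith
  unfold singleHitWeight
  split_ifs
  · simp
  · have h : ∀ t : α, (if t = z then 0 else 1 / ((Fintype.card α : ℝ) - 1)) =
        1 / ((Fintype.card α : ℝ) - 1) -
          if t = z then 1 / ((Fintype.card α : ℝ) - 1) else 0 := by
      intro t
      split_ifs <;> simp
    simp only [h, Finset.sum_sub_distrib, Finset.sum_const, Finset.card_univ, nsmul_eq_mul,
      Finset.sum_ite_eq', Finset.mem_univ, if_true]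
    field_simp

theorem singleHitWeight_nonneg {ι α : Type*} [DecidableEq ι] [Fintype α] [DecidableEq α]
    (hα : 2 ≤ Fintype.card α) (z : α) (k i : ι) (t : α) : 0 ≤ singleHitWeight z k i t := by
  have hq : (2 : ℝ) ≤ Fintype.card α := by exact_mod_cast hα
  have h : 0 ≤ 1 / ((Fintype.card α : ℝ) - 1) := by
    apply one_div_nonneg.mpr
    linarith
  unfold singleHitWeight
  split_ifs <;> first | exact h | norm_num

theorem sum_ite_mul_ite {ι : Type*} [Fintype ι] [DecidableEq ι] {i j : ι} (hij : i ≠ j)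
    (A A' B B' : ℝ) :
    ∑ k, (if i = k then A else A') * (if j = k then B else B') =
      A * B' + A' * B + ((Fintype.card ι : ℝ) - 2) * (A' * B') := by
  have h : ∀ k, (if i = k then A else A') * (if j = k then B else B') =
      A' * B' + (if i = k then (A - A') * B' else 0) +
        (if j = k then A' * (B - B') else 0) := by
    intro k
    by_cases hi : i = k
    · subst hi
      simp [hij.symm]
      ring
    · by_cases hj : j = k
      · simp [hi, hj]
        ring
      · simp [hi, hj]
  simp only [h, Finset.sum_add_distrib, Finset.sum_const, Finset.card_univ, nsmul_eq_mul,
    Finset.sum_ite_eq, Finset.mem_univ, if_true]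
  ring

/-- With one coordinate more than there are symbols, some pairwise independent distribution with
uniform marginals is supported on tuples that contain the symbol `z`: with probability `1 / q ^ 2`
all coordinates are `z`, and otherwise exactly one uniformly chosen coordinate is `z`, the others
being independent and uniform on the remaining symbols. -/
theorem exists_pairwise_independent_hitting {ι α : Type*} [Fintype ι] [DecidableEq ι] [Fintype α]
    [DecidableEq α] (hα : 2 ≤ Fintype.card α) (hι : Fintype.card ι = Fintype.card α + 1) (z : α) :
    ∃ μ : (ι → α) → ℝ,
      (∀ x, 0 ≤ μ x) ∧ (∑ x, μ x = 1) ∧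
      (∀ i j : ι, i ≠ j → ∀ a b : α,
        ∑ x : ι → α with x i = a ∧ x j = b, μ x = 1 / (Fintype.card α : ℝ) ^ 2) ∧
      (∀ x, μ x ≠ 0 → ∃ i, x i = z) := by
  have hq : (2 : ℝ) ≤ Fintype.card α := by exact_mod_cast hα
  have hn : (Fintype.card ι : ℝ) = Fintype.card α + 1 := by exact_mod_cast hι
  have hw := sum_singleHitWeight (ι := ι) hα z
  have hpoint : ∀ i : ι, ∑ t : α, (fun (_ : ι) (t : α) => if t = z then (1 : ℝ) else 0) i t = 1 := by
    simp
  have hsum := sum_prod_weights_eq_one _ hpoint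
  have hmarg := fun (i j : ι) (hij : i ≠ j) => sum_filter_prod_weights _ hpoint hij
  set q := (Fintype.card α : ℝ) with hq_def
  have hq0 : q ≠ 0 := by linarith
  have hq1 : q - 1 ≠ 0 := by linarith
  refine ⟨fun x => 1 / q ^ 2 * ∏ i, (if x i = z then (1 : ℝ) else 0) +
    ∑ k, (q - 1) / q ^ 2 * ∏ i, singleHitWeight z k i (x i), ?_, ?_, ?_, ?_⟩
  · intro x
    refine add_nonneg (mul_nonneg (by positivity) (Finset.prod_nonneg fun i _ => ?_))
      (Finset.sum_nonneg fun k _ => mul_nonneg (div_nonneg (by linarith) (by positivity))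
        (Finset.prod_nonneg fun i _ => singleHitWeight_nonneg hα z k i _))
    split_ifs <;> norm_num
  · rw [Finset.sum_add_distrib, Finset.sum_comm]
    simp only [← Finset.mul_sum, hsum, sum_prod_weights_eq_one _ (hw _), Finset.sum_const,
      Finset.card_univ, nsmul_eq_mul, hn]
    field_simp
    ring
  · intro i j hij a b
    rw [Finset.sum_add_distrib, Finset.sum_comm]
    simp only [← Finset.mul_sum, hmarg i j hij, sum_filter_prod_weights _ (hw _) hij]
    unfold singleHitWeight
    rw [sum_ite_mul_ite hij, hn, ← hq_def]
    split_ifs <;> field_simp <;> ring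
  · intro x hx
    by_contra! hno
    apply hx
    have hne : Nonempty ι := Fintype.card_pos_iff.mp (by omega)
    obtain ⟨i₀⟩ := hne
    have h1 : ∏ i, (if x i = z then (1 : ℝ) else 0) = 0 :=
      Finset.prod_eq_zero (Finset.mem_univ i₀) (by simp [hno i₀])
    have h2 : ∀ k, ∏ i, singleHitWeight z k i (x i) = 0 := fun k =>
      Finset.prod_eq_zero (Finset.mem_univ k) (by simp [singleHitWeight, hno k])
    simp [h1, h2]

theorem pairwise_independent_distribution_exists (d : ℕ) (hd : 3 ≤ d) :
    ∃ μ : (Fin d → Fin (d - 1)) → ℝ,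
      (∀ x, 0 ≤ μ x) ∧
      (∑ x : Fin d → Fin (d - 1), μ x = 1) ∧
      (∀ i j : Fin d, i < j → ∀ ti tj : Fin (d - 1),
        (∑ x ∈ Finset.univ.filter (fun x : Fin d → Fin (d - 1) => x i = ti ∧ x j = tj),
          μ x) = 1 / ((d : ℝ) - 1) ^ 2) ∧
      (∀ x : Fin d → Fin (d - 1), μ x ≠ 0 → ∃ i : Fin d, x i = ⟨0, by omega⟩) := by
  obtain ⟨μ, hnonneg, hsum, hpair, hhit⟩ := exists_pairwise_independent_hitting
    (ι := Fin d) (α := Fin (d - 1)) (by simp; omega) (by simp; omega) ⟨0, by omega⟩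
  refine ⟨μ, hnonneg, hsum, fun i j hij ti tj => ?_, hhit⟩
  rw [hpair i j hij.ne ti tj, Fintype.card_fin, Nat.cast_sub (by omega), Nat.cast_one]
end

section
/- For d = 10, for every p ∈ [0,1], one has h(p,10) = 1 + (1 - (1-p)/9)^{10} + (1 - min(1, (1 + 9p)/9))^{10} ≥ 1.41. (Consequently there exists an integer d ≥ 3 with min over p ∈ [0,1] of h(p,d) ≥ 1.41, which is the numerical content of the hardness bound max_{d ≥ 3} min_{p ∈ [0,1]} h(p,d) ≈ 1.416.) -/
noncomputable def h (p : ℝ) (d : ℕ) : ℝ :=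
  1 + (1 - (1 - p) / ((d : ℝ) - 1)) ^ d
    + (1 - min 1 ((p * d + (1 - p)) / ((d : ℝ) - 1))) ^ d

/-- The graph of `x ↦ x ^ n` lies above its tangent line at `a > 0`. -/
theorem tangent_le_pow {a x : ℝ} (ha : 0 < a) (hx : 0 ≤ x) (n : ℕ) :
    a ^ n * (1 + n * (x / a - 1)) ≤ x ^ n := by
  have hxa : 0 ≤ x / a := div_nonneg hx ha.le
  calc a ^ n * (1 + n * (x / a - 1)) ≤ a ^ n * (1 + (x / a - 1)) ^ n :=
        mul_le_mul_of_nonneg_left (one_add_mul_le_pow (by linarith) n) (by positivity)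
    _ = x ^ n := by rw [← mul_pow]; congr 1; field_simp; ring

/-- Tangent lines at the near-minimizer `p = 0.177` give the bound by convexity. -/
theorem cost_bound_ten {p : ℝ} (hp : p ∈ Set.Icc (0 : ℝ) 1) :
    (1.41 : ℝ) ≤ 1 + (1 - (1 - p) / 9) ^ 10 + (1 - min 1 ((1 + 9 * p) / 9)) ^ 10 := by
  obtain ⟨hp0, hp1⟩ := hp
  have hm0 : 0 ≤ 1 - min 1 ((1 + 9 * p) / 9) := sub_nonneg.2 (min_le_left _ _)
  have hm1 : 8 / 9 - p ≤ 1 - min 1 ((1 + 9 * p) / 9) := by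
    linarith [min_le_right 1 ((1 + 9 * p) / 9)]
  have h₁ := tangent_le_pow (a := 8177 / 9000) (by norm_num)
    (show 0 ≤ 1 - (1 - p) / 9 by linarith) 10
  have h₂ := tangent_le_pow (a := 6407 / 9000) (by norm_num) hm0 10
  generalize 1 - min 1 ((1 + 9 * p) / 9) = m at *
  norm_num at h₁ h₂ ⊢
  linarith

theorem hardness_bound_d_ten :
    (∀ p ∈ Set.Icc (0 : ℝ) 1,
      (1.41 : ℝ) ≤ 1 + (1 - (1 - p) / 9) ^ 10 + (1 - min 1 ((1 + 9 * p) / 9)) ^ 10) ∧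
    (∃ d : ℕ, 3 ≤ d ∧ ∀ p ∈ Set.Icc (0 : ℝ) 1, (1.41 : ℝ) ≤ h p d) := by
  refine ⟨fun p hp => cost_bound_ten hp, 10, by norm_num, fun p hp => ?_⟩
  have key := cost_bound_ten hp
  have e₁ : ((10 : ℕ) : ℝ) - 1 = 9 := by norm_num
  have e₂ : p * ((10 : ℕ) : ℝ) + (1 - p) = 1 + 9 * p := by push_cast; ring
  rwa [h, e₁, e₂]
end
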